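/- Let ∇ be a freshness context and σ, θ substitutions. If σ respects ∇ and θ respects ∇σ, then the composition σθ respects ∇ and (∇σ)θ = ∇(σθ). -/

import Mathlib

set_option maxHeartbeats 1000000
abbrev Atom := ℕ
abbrev Var := ℕ
abbrev Fn := ℕ
abbrev NPerm := List (Atom × Atom)
def swapAtom (a b c : Atom) : Atom := if c = a then b else if c = b then a else c
def permAtom : NPerm → Atom → Atom
  | [], c => c
  | (a, b) :: π, c => swapAtom a b (permAtom π c)
def permInv (π : NPerm) : NPerm := π.reverse
inductive NTerm where
  | app : Fn → List NTerm → NTerm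
  | atom : Atom → NTerm
  | abs : Atom → NTerm → NTerm
  | susp : NPerm → Var → NTerm

def permTerm (π : NPerm) : NTerm → NTerm
  | .app f ts => .app f (ts.attach.map (fun x => permTerm π x.1))
  | .atom a => .atom (permAtom π a)
  | .abs a t => .abs (permAtom π a) (permTerm π t)
  | .susp ρ X => .susp (π ++ ρ) X
decreasing_by
  all_goals (simp_wf; try omega)
  all_goals (have := List.sizeOf_lt_of_mem x.2; omega)

/-- Substitutions (total maps from variables to terms; identity almost everywhere
is not required for the statements). -/
abbrev NSubst := Var → NTerm

def idSubst : NSubst := fun X => .susp [] X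

/-- Application of a substitution to a term (allowing atom capture and forcing
suspended permutations). -/
def substTerm (σ : NSubst) : NTerm → NTerm
  | .app f ts => .app f (ts.attach.map (fun x => substTerm σ x.1))
  | .atom a => .atom a
  | .abs a t => .abs a (substTerm σ t)
  | .susp π X => permTerm π (σ X)
decreasing_by
  all_goals (simp_wf; try omega)
  all_goals (have := List.sizeOf_lt_of_mem x.2; omega)

/-- Composition of substitutions: `t (σθ) = (tσ)θ`. -/
def substComp (σ θ : NSubst) : NSubst := fun X => substTerm θ (σ X)

/-- Freshness contexts: finite sets of constraints `a # X`. -/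
abbrev FCtx := Finset (Atom × Var)

/-- The freshness relation `Δ ⊢ a # t` (Urban–Pitts–Gabbay rules), stated for an
arbitrary set of freshness constraints. -/
inductive NFresh (Δ : Set (Atom × Var)) : Atom → NTerm → Prop
  | atom {a b : Atom} : a ≠ b → NFresh Δ a (.atom b)
  | susp {a : Atom} {π : NPerm} {X : Var} :
      (permAtom (permInv π) a, X) ∈ Δ → NFresh Δ a (.susp π X)
  | app {a : Atom} {f : Fn} {ts : List NTerm} :
      (∀ t ∈ ts, NFresh Δ a t) → NFresh Δ a (.app f ts)
  | abs1 {a : Atom} {t : NTerm} : NFresh Δ a (.abs a t)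
  | abs2 {a b : Atom} {t : NTerm} : a ≠ b → NFresh Δ a t → NFresh Δ a (.abs b t)

/-- The α-equivalence relation `Δ ⊢ t ≈ s` (Urban–Pitts–Gabbay rules). -/
inductive NAlpha (Δ : Set (Atom × Var)) : NTerm → NTerm → Prop
  | atom (a : Atom) : NAlpha Δ (.atom a) (.atom a)
  | abs1 {a : Atom} {t t' : NTerm} : NAlpha Δ t t' → NAlpha Δ (.abs a t) (.abs a t')
  | abs2 {a b : Atom} {t t' : NTerm} : a ≠ b → NAlpha Δ t (permTerm [(a, b)] t') →
      NFresh Δ a t' → NAlpha Δ (.abs a t) (.abs b t')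
  | susp {π π' : NPerm} {X : Var} :
      (∀ a : Atom, permAtom π a ≠ permAtom π' a → (a, X) ∈ Δ) →
      NAlpha Δ (.susp π X) (.susp π' X)
  | app {f : Fn} {ts ss : List NTerm} : ts.length = ss.length →
      (∀ p ∈ List.zip ts ss, NAlpha Δ p.1 p.2) →
      NAlpha Δ (.app f ts) (.app f ss)

/-- `FA⁻ˢ(t)`: atoms occurring freely in `t`, ignoring suspensions. -/
def FAnoSusp : NTerm → Finset Atom
  | .app _ ts => (ts.attach.map (fun x => FAnoSusp x.1)).foldr (· ∪ ·) ∅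
  | .atom a => {a}
  | .abs a t => FAnoSusp t \ {a}
  | .susp _ _ => ∅
decreasing_by
  all_goals (simp_wf; try omega)
  all_goals (have := List.sizeOf_lt_of_mem x.2; omega)

/-- A substitution respects a freshness context. -/
def Respects (σ : NSubst) (Δ : FCtx) : Prop :=
  ∀ a X, (a, X) ∈ Δ → a ∉ FAnoSusp (σ X)

/-! ### The algorithm FC -/

/-- A finite set of atomic freshness formulas `a # t`. -/
abbrev FProb := Multiset (Atom × NTerm)

/-- One step of the algorithm FC, transforming pairs `(F; Δ)`. -/
inductive FCStep : FProb × FCtx → FProb × FCtx → Prop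
  | del {a b : Atom} {F : FProb} {Δ : FCtx} : a ≠ b →
      FCStep ((a, .atom b) ::ₘ F, Δ) (F, Δ)
  | abs1 {a : Atom} {t : NTerm} {F : FProb} {Δ : FCtx} :
      FCStep ((a, .abs a t) ::ₘ F, Δ) (F, Δ)
  | abs2 {a b : Atom} {t : NTerm} {F : FProb} {Δ : FCtx} : a ≠ b →
      FCStep ((a, .abs b t) ::ₘ F, Δ) ((a, t) ::ₘ F, Δ)
  | dec {a : Atom} {f : Fn} {ts : List NTerm} {F : FProb} {Δ : FCtx} :
      FCStep ((a, .app f ts) ::ₘ F, Δ) (↑(ts.map (fun t => (a, t))) + F, Δ)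
  | sus {a : Atom} {π : NPerm} {X : Var} {F : FProb} {Δ : FCtx} :
      FCStep ((a, .susp π X) ::ₘ F, Δ) (F, insert (permAtom (permInv π) a, X) Δ)

/-- The algorithm FC succeeds on `F` with result `Γ`. -/
def FCReaches (F : FProb) (Γ : FCtx) : Prop :=
  Relation.ReflTransGen FCStep (F, ∅) (0, Γ)

/-- The algorithm FC fails on `F` (reaches a stuck state with remaining formulas). -/
def FCFails (F : FProb) : Prop :=
  ∃ st : FProb × FCtx, Relation.ReflTransGen FCStep (F, ∅) st ∧ st.1 ≠ 0 ∧
    ∀ st', ¬ FCStep st st'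

/-- The freshness problem `{a # Xσ | a#X ∈ Δ}` defining the instance `Δσ`. -/
def ctxSubstProb (Δ : FCtx) (σ : NSubst) : FProb :=
  Δ.val.map (fun c => (c.1, σ c.2))

/-! ### Terms-in-context and the subsumption order -/

/-- A term-in-context. -/
abbrev TIC := FCtx × NTerm

/-- `p ⪯ q`: the term-in-context `p` is more general than `q`.  (The condition
`p.1 σ ⊆ q.1` is expressed, equivalently by the properties of FC, as
`q.1 ⊢ a # Xσ` for all `a # X ∈ p.1`.) -/
def TIC.Le (p q : TIC) : Prop :=
  ∃ σ : NSubst, Respects σ p.1 ∧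
    (∀ c ∈ p.1, NFresh (↑q.1 : Set (Atom × Var)) c.1 (σ c.2)) ∧
    NAlpha (↑q.1 : Set (Atom × Var)) (substTerm σ p.2) q.2

/-- The strict part of `⪯`. -/
def TIC.Lt (p q : TIC) : Prop := TIC.Le p q ∧ ¬ TIC.Le q p

/-- Equi-generality `≃`. -/
def TIC.Equiv (p q : TIC) : Prop := TIC.Le p q ∧ TIC.Le q p

/-- `r` is a generalization of `p₁` and `p₂`. -/
def IsGen (r p₁ p₂ : TIC) : Prop := TIC.Le r p₁ ∧ TIC.Le r p₂

/-! ### Atoms, variables, basedness -/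

def permAtoms : NPerm → Finset Atom
  | [] => ∅
  | (a, b) :: π => insert a (insert b (permAtoms π))

def termAtoms : NTerm → Finset Atom
  | .app _ ts => (ts.attach.map (fun x => termAtoms x.1)).foldr (· ∪ ·) ∅
  | .atom a => {a}
  | .abs a t => insert a (termAtoms t)
  | .susp π _ => permAtoms π
decreasing_by
  all_goals (simp_wf; try omega)
  all_goals (have := List.sizeOf_lt_of_mem x.2; omega)

def termVars : NTerm → Finset Var
  | .app _ ts => (ts.attach.map (fun x => termVars x.1)).foldr (· ∪ ·) ∅
  | .atom _ => ∅
  | .abs _ t => termVars t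
  | .susp _ X => {X}
decreasing_by
  all_goals (simp_wf; try omega)
  all_goals (have := List.sizeOf_lt_of_mem x.2; omega)

/-- `FA(t)`: the atoms occurring freely in `t` (with `FA(π·X) = Atoms(π)`). -/
def termFA : NTerm → Finset Atom
  | .app _ ts => (ts.attach.map (fun x => termFA x.1)).foldr (· ∪ ·) ∅
  | .atom a => {a}
  | .abs a t => termFA t \ {a}
  | .susp π _ => permAtoms π
decreasing_by
  all_goals (simp_wf; try omega)
  all_goals (have := List.sizeOf_lt_of_mem x.2; omega)

def ctxAtoms (Δ : FCtx) : Finset Atom := Δ.image Prod.fst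
def ctxVars (Δ : FCtx) : Finset Var := Δ.image Prod.snd

def permBased (π : NPerm) (A : Finset Atom) : Prop := permAtoms π ⊆ A
def termBased (t : NTerm) (A : Finset Atom) : Prop := termAtoms t ⊆ A
def ctxBased (Δ : FCtx) (A : Finset Atom) : Prop := ctxAtoms Δ ⊆ A
def ticBased (p : TIC) (A : Finset Atom) : Prop := ctxBased p.1 A ∧ termBased p.2 A

/-- The number of abstraction occurrences in a term. -/
def absCount : NTerm → ℕ
  | .app _ ts => (ts.attach.map (fun x => absCount x.1)).sum
  | .atom _ => 0
  | .abs _ t => absCount t + 1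
  | .susp _ _ => 0
decreasing_by
  all_goals (simp_wf; try omega)
  all_goals (have := List.sizeOf_lt_of_mem x.2; omega)

/-! ### The nominal anti-unification algorithm 𝔑 -/

/-- Anti-unification triple `X : t ≜ s`. -/
abbrev AUT := Var × NTerm × NTerm

/-- A state of the algorithm 𝔑: the unsolved triples `P`, the store `S`, the
freshness context `Γ`, the substitution `σ`, and the set `V` of variables used
so far (needed to express freshness of the generated variables). -/
structure NState where
  P : Multiset AUT
  S : Multiset AUT
  Γ : FCtx
  σ : NSubst
  V : Finset Var

/-- `σ{X ↦ u}`. -/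
def updSubst (σ : NSubst) (X : Var) (u : NTerm) : NSubst :=
  substComp σ (fun Z => if Z = X then u else .susp [] Z)

/-- The head of a term (a function symbol together with its arity, an atom, the
abstraction operator, or a variable). -/
inductive NHead where
  | fn : Fn → ℕ → NHead
  | atom : Atom → NHead
  | abs : NHead
  | var : Var → NHead
deriving DecidableEq

def headOf : NTerm → NHead
  | .app f ts => .fn f ts.length
  | .atom a => .atom a
  | .abs _ _ => .abs
  | .susp _ X => .var X

def IsSusp : NTerm → Prop
  | .susp _ _ => True
  | _ => False

def IsAbs : NTerm → Prop
  | .abs _ _ => True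
  | _ => False

/-- The applicability condition of the rule Sol. -/
def SolCond (A : Finset Atom) (Δ : FCtx) (t s : NTerm) : Prop :=
  headOf t ≠ headOf s ∨ (IsSusp t ∧ IsSusp s) ∨
    (IsAbs t ∧ IsAbs s ∧
      ¬ ∃ c ∈ A, NFresh (↑Δ : Set (Atom × Var)) c t ∧ NFresh (↑Δ : Set (Atom × Var)) c s)

open Classical in
/-- `{a # X | a ∈ A, Δ ⊢ a # t, Δ ⊢ a # s}`. -/
noncomputable def solSet (A : Finset Atom) (Δ : FCtx) (t s : NTerm) (X : Var) : FCtx :=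
  (A.filter (fun a =>
    NFresh (↑Δ : Set (Atom × Var)) a t ∧ NFresh (↑Δ : Set (Atom × Var)) a s)).image
    (fun a => (a, X))

/-- `Γ{Y ↦ π·X}` on a freshness context. -/
def ctxRename (Γ : FCtx) (Y : Var) (π : NPerm) (X : Var) : FCtx :=
  Γ.image (fun c => if c.2 = Y then (permAtom (permInv π) c.1, X) else c)

/-- One step of the algorithm 𝔑, with global parameters `A` and `Δ`. -/
inductive NStep (A : Finset Atom) (Δ : FCtx) : NState → NState → Prop
  | decApp {X : Var} {f : Fn} {ts ss : List NTerm} {P S : Multiset AUT} {Γ : FCtx}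
      {σ : NSubst} {V : Finset Var} (Ys : List Var) :
      ts.length = ss.length → Ys.length = ts.length → Ys.Nodup →
      (∀ Y ∈ Ys, Y ∉ V) →
      NStep A Δ ⟨(X, .app f ts, .app f ss) ::ₘ P, S, Γ, σ, V⟩
        ⟨↑(List.zipWith (fun Y p => (Y, p)) Ys (List.zip ts ss)) + P, S, Γ,
         updSubst σ X (.app f (Ys.map (fun Y => .susp [] Y))), V ∪ Ys.toFinset⟩
  | decAtom {X : Var} {a : Atom} {P S : Multiset AUT} {Γ : FCtx} {σ : NSubst}
      {V : Finset Var} :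
      NStep A Δ ⟨(X, .atom a, .atom a) ::ₘ P, S, Γ, σ, V⟩
        ⟨P, S, Γ, updSubst σ X (.atom a), V⟩
  | abs {X : Var} {a b : Atom} {t s : NTerm} {P S : Multiset AUT} {Γ : FCtx}
      {σ : NSubst} {V : Finset Var} (Y : Var) (c : Atom) :
      Y ∉ V → c ∈ A →
      NFresh (↑Δ : Set (Atom × Var)) c (.abs a t) →
      NFresh (↑Δ : Set (Atom × Var)) c (.abs b s) →
      NStep A Δ ⟨(X, .abs a t, .abs b s) ::ₘ P, S, Γ, σ, V⟩
        ⟨(Y, permTerm [(c, a)] t, permTerm [(c, b)] s) ::ₘ P, S, Γ,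
         updSubst σ X (.abs c (.susp [] Y)), insert Y V⟩
  | sol {X : Var} {t s : NTerm} {P S : Multiset AUT} {Γ : FCtx} {σ : NSubst}
      {V : Finset Var} :
      SolCond A Δ t s →
      NStep A Δ ⟨(X, t, s) ::ₘ P, S, Γ, σ, V⟩
        ⟨P, (X, t, s) ::ₘ S, Γ ∪ solSet A Δ t s X, σ, V⟩
  | mer {X Y : Var} {t₁ s₁ t₂ s₂ : NTerm} {P S : Multiset AUT} {Γ : FCtx}
      {σ : NSubst} {V : Finset Var} (π : NPerm) :
      X ≠ Y →
      permBased π (termAtoms t₁ ∪ termAtoms s₁ ∪ termAtoms t₂ ∪ termAtoms s₂) →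
      NAlpha (↑Δ : Set (Atom × Var)) (permTerm π t₁) t₂ →
      NAlpha (↑Δ : Set (Atom × Var)) (permTerm π s₁) s₂ →
      NStep A Δ ⟨P, (X, t₁, s₁) ::ₘ (Y, t₂, s₂) ::ₘ S, Γ, σ, V⟩
        ⟨P, (X, t₁, s₁) ::ₘ S, ctxRename Γ Y π X, updSubst σ Y (.susp π X), V⟩

/-- The initial state of 𝔑 on the triple `X : t ≜ s`. -/
def initNState (X : Var) (t s : NTerm) (Δ : FCtx) : NState :=
  ⟨{(X, t, s)}, 0, ∅, idSubst, insert X (termVars t ∪ termVars s ∪ ctxVars Δ)⟩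

/-- An `A`-based least general generalization of `p₁` and `p₂`. -/
def IsABasedLgg (A : Finset Atom) (p p₁ p₂ : TIC) : Prop :=
  ticBased p A ∧ IsGen p p₁ p₂ ∧
    ¬ ∃ p' : TIC, ticBased p' A ∧ IsGen p' p₁ p₂ ∧ TIC.Lt p p'

/-! ### The equivariance algorithm 𝔈 -/

/-- A set of equivariance equations `t ≈ s`. -/
abbrev EProb := Multiset (NTerm × NTerm)

def eqsAtoms (E : EProb) : Finset Atom :=
  (E.map (fun e => termAtoms e.1 ∪ termAtoms e.2)).sup

def eqsVars (E : EProb) : Finset Var :=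
  (E.map (fun e => termVars e.1 ∪ termVars e.2)).sup

/-- All equations of `E` are equations between atoms. -/
def AtomEqs (E : EProb) : Prop := ∀ e ∈ E, ∃ a b : Atom, e = (NTerm.atom a, NTerm.atom b)

/-- One step of the equivariance algorithm 𝔈 (with fixed freshness context `Δ`) on
states `(E; A; π)`.  The first-phase rules require `π = Id`; the second-phase
rules require that only equations between atoms are left. -/
inductive EStep (Δ : FCtx) :
    EProb × Finset Atom × NPerm → EProb × Finset Atom × NPerm → Prop
  | dec {f : Fn} {ts ss : List NTerm} {E : EProb} {A : Finset Atom} :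
      ts.length = ss.length →
      EStep Δ ((.app f ts, .app f ss) ::ₘ E, A, []) (↑(List.zip ts ss) + E, A, [])
  | alp {a b : Atom} {t s : NTerm} {E : EProb} {A : Finset Atom} (c : Atom) :
      c ∉ A → c ∉ eqsAtoms ((.abs a t, .abs b s) ::ₘ E) → c ∉ ctxAtoms Δ →
      EStep Δ ((.abs a t, .abs b s) ::ₘ E, A, [])
        ((permTerm [(c, a)] t, permTerm [(c, b)] s) ::ₘ E, A, [])
  | sus {π₁ π₂ : NPerm} {X : Var} {E : EProb} {A : Finset Atom} :
      EStep Δ ((.susp π₁ X, .susp π₂ X) ::ₘ E, A, [])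
        (↑((A.filter (fun a => (a, X) ∉ Δ)).toList.map
            (fun a => (NTerm.atom (permAtom π₁ a), NTerm.atom (permAtom π₂ a)))) + E,
         A, [])
  | rem {a b : Atom} {E : EProb} {A : Finset Atom} {π : NPerm} :
      AtomEqs ((.atom a, .atom b) ::ₘ E) → permAtom π a = b →
      EStep Δ ((.atom a, .atom b) ::ₘ E, A, π) (E, A.erase b, π)
  | sol {a b : Atom} {E : EProb} {A : Finset Atom} {π : NPerm} :
      AtomEqs ((.atom a, .atom b) ::ₘ E) →
      permAtom π a ∈ A → b ∈ A → permAtom π a ≠ b →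
      EStep Δ ((.atom a, .atom b) ::ₘ E, A, π) (E, A.erase b, (permAtom π a, b) :: π)

@[elab_as_elim]
theorem NTerm.induction_mem {P : NTerm → Prop}
    (app : ∀ f ts, (∀ t ∈ ts, P t) → P (.app f ts)) (atom : ∀ a, P (.atom a))
    (abs : ∀ a t, P t → P (.abs a t)) (susp : ∀ π X, P (.susp π X)) (t : NTerm) : P t :=
  NTerm.rec (motive_1 := P) (motive_2 := fun ts => ∀ t ∈ ts, P t)
    (fun f ts ih => app f ts ih) atom (fun a t ih => abs a t ih) susp
    (fun _ h => absurd h List.not_mem_nil)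
    (fun _ _ h₁ h₂ _ h => (List.mem_cons.mp h).elim (fun e => e ▸ h₁) (h₂ _)) t

theorem permAtom_append (π ρ : NPerm) (a : Atom) :
    permAtom (π ++ ρ) a = permAtom π (permAtom ρ a) := by
  induction π with
  | nil => rfl
  | cons p π ih => simp [permAtom, ih]

theorem swapAtom_swapAtom (a b c : Atom) : swapAtom a b (swapAtom a b c) = c := by
  unfold swapAtom
  split_ifs <;> simp_all

theorem permInv_append (π ρ : NPerm) : permInv (π ++ ρ) = permInv ρ ++ permInv π := by
  simp [permInv]

theorem permInv_permInv (π : NPerm) : permInv (permInv π) = π := by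
  simp [permInv]

theorem permAtom_permInv (π : NPerm) (a : Atom) : permAtom π (permAtom (permInv π) a) = a := by
  induction π generalizing a with
  | nil => rfl
  | cons p π ih =>
    have h : permInv (p :: π) = permInv π ++ [p] := by simp [permInv]
    rw [h, permAtom_append]
    simp [permAtom, ih, swapAtom_swapAtom]

theorem permAtom_eq_iff (π : NPerm) (a b : Atom) :
    a = permAtom π b ↔ permAtom (permInv π) a = b := by
  constructor
  · rintro rfl
    simpa [permInv_permInv] using permAtom_permInv (permInv π) b
  · rintro rfl
    exact (permAtom_permInv π a).symm

theorem permTerm_app (π : NPerm) (f : Fn) (ts : List NTerm) :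
    permTerm π (.app f ts) = .app f (ts.map (permTerm π)) := by
  simp [permTerm]

theorem substTerm_app (σ : NSubst) (f : Fn) (ts : List NTerm) :
    substTerm σ (.app f ts) = .app f (ts.map (substTerm σ)) := by
  simp [substTerm]

theorem mem_FAnoSusp_app {a : Atom} {f : Fn} {ts : List NTerm} :
    a ∈ FAnoSusp (.app f ts) ↔ ∃ t ∈ ts, a ∈ FAnoSusp t := by
  have h : FAnoSusp (.app f ts) = (ts.map FAnoSusp).foldr (· ∪ ·) ∅ := by
    simp [FAnoSusp]
  rw [h]
  clear h
  induction ts with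
  | nil => simp
  | cons t ts ih => simp_all

/-- The constraint `c` is produced when FC decomposes the formula `a # t`. -/
inductive NEmits : Atom → NTerm → Atom × Var → Prop
  | susp {a : Atom} {π : NPerm} {X : Var} :
      NEmits a (.susp π X) (permAtom (permInv π) a, X)
  | app {a : Atom} {f : Fn} {ts : List NTerm} {t : NTerm} {c : Atom × Var} :
      t ∈ ts → NEmits a t c → NEmits a (.app f ts) c
  | abs {a b : Atom} {t : NTerm} {c : Atom × Var} :
      a ≠ b → NEmits a t c → NEmits a (.abs b t) c

namespace NEmits

theorem atom_iff {a b : Atom} {c : Atom × Var} : NEmits a (.atom b) c ↔ False :=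
  ⟨(fun h => nomatch h), False.elim⟩

theorem susp_iff {a : Atom} {π : NPerm} {X : Var} {c : Atom × Var} :
    NEmits a (.susp π X) c ↔ c = (permAtom (permInv π) a, X) :=
  ⟨fun h => by cases h; rfl, fun h => h ▸ .susp⟩

theorem app_iff {a : Atom} {f : Fn} {ts : List NTerm} {c : Atom × Var} :
    NEmits a (.app f ts) c ↔ ∃ t ∈ ts, NEmits a t c :=
  ⟨fun h => by cases h with | app ht h => exact ⟨_, ht, h⟩, fun ⟨_, ht, h⟩ => .app ht h⟩

theorem abs_iff {a b : Atom} {t : NTerm} {c : Atom × Var} :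
    NEmits a (.abs b t) c ↔ a ≠ b ∧ NEmits a t c :=
  ⟨fun h => by cases h with | abs hab h => exact ⟨hab, h⟩, fun ⟨hab, h⟩ => .abs hab h⟩

theorem permTerm_iff (π : NPerm) {a : Atom} {t : NTerm} {c : Atom × Var} :
    NEmits a (permTerm π t) c ↔ NEmits (permAtom (permInv π) a) t c := by
  induction t using NTerm.induction_mem with
  | app f ts ih =>
    simp only [permTerm_app, app_iff, List.mem_map, exists_exists_and_eq_and]
    exact exists_congr fun t => and_congr_right fun ht => ih t ht
  | atom b => simp [permTerm, atom_iff]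
  | abs b t ih => simp [permTerm, abs_iff, ih, permAtom_eq_iff]
  | susp ρ X => simp [permTerm, susp_iff, permInv_append, permAtom_append]

theorem substTerm_iff (θ : NSubst) {a : Atom} {t : NTerm} {c : Atom × Var} :
    NEmits a (substTerm θ t) c ↔ ∃ d, NEmits a t d ∧ NEmits d.1 (θ d.2) c := by
  induction t using NTerm.induction_mem with
  | app f ts ih =>
    simp only [substTerm_app, app_iff, List.mem_map, exists_exists_and_eq_and]
    constructor
    · rintro ⟨t, ht, h⟩
      obtain ⟨d, h₁, h₂⟩ := (ih t ht).1 h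
      exact ⟨d, ⟨t, ht, h₁⟩, h₂⟩
    · rintro ⟨d, ⟨t, ht, h₁⟩, h₂⟩
      exact ⟨t, ht, (ih t ht).2 ⟨d, h₁, h₂⟩⟩
  | atom b => simp [substTerm, atom_iff]
  | abs b t ih => simp [substTerm, abs_iff, ih, and_assoc]
  | susp ρ X => simp [substTerm, susp_iff, permTerm_iff]

end NEmits

theorem mem_FAnoSusp_permTerm (π : NPerm) {a : Atom} {t : NTerm} :
    a ∈ FAnoSusp (permTerm π t) ↔ permAtom (permInv π) a ∈ FAnoSusp t := by
  induction t using NTerm.induction_mem with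
  | app f ts ih =>
    simp only [permTerm_app, mem_FAnoSusp_app, List.mem_map, exists_exists_and_eq_and]
    exact exists_congr fun t => and_congr_right fun ht => ih t ht
  | atom b => simp [permTerm, FAnoSusp, permAtom_eq_iff]
  | abs b t ih => simp [permTerm, FAnoSusp, ih, permAtom_eq_iff]
  | susp ρ X => simp [permTerm, FAnoSusp]

theorem mem_FAnoSusp_substTerm (θ : NSubst) {a : Atom} {t : NTerm}
    (h : a ∈ FAnoSusp (substTerm θ t)) :
    a ∈ FAnoSusp t ∨ ∃ d, NEmits a t d ∧ d.1 ∈ FAnoSusp (θ d.2) := by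
  induction t using NTerm.induction_mem with
  | app f ts ih =>
    simp only [substTerm_app, mem_FAnoSusp_app, List.mem_map, exists_exists_and_eq_and] at h
    obtain ⟨t, ht, h⟩ := h
    rcases ih t ht h with h | ⟨d, h₁, h₂⟩
    · exact .inl (mem_FAnoSusp_app.2 ⟨t, ht, h⟩)
    · exact .inr ⟨d, .app ht h₁, h₂⟩
  | atom b => exact .inl (by simpa [substTerm] using h)
  | abs b t ih =>
    simp only [substTerm, FAnoSusp, Finset.mem_sdiff, Finset.mem_singleton] at h ⊢
    rcases ih h.1 with h' | ⟨d, h₁, h₂⟩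
    · exact .inl ⟨h', h.2⟩
    · exact .inr ⟨d, .abs h.2 h₁, h₂⟩
  | susp ρ X =>
    simp only [substTerm, mem_FAnoSusp_permTerm] at h
    exact .inr ⟨_, .susp, h⟩

/-- FC steps preserve the constraints of a pair, both recorded and still to be produced. -/
theorem FCStep.mem_or_emits_iff {s s' : FProb × FCtx} (h : FCStep s s') (c : Atom × Var) :
    (c ∈ s.2 ∨ ∃ p ∈ s.1, NEmits p.1 p.2 c) ↔ (c ∈ s'.2 ∨ ∃ p ∈ s'.1, NEmits p.1 p.2 c) := by
  cases h with
  | del _ => simp [NEmits.atom_iff]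
  | abs1 => simp [NEmits.abs_iff]
  | abs2 hab => simp [NEmits.abs_iff, hab]
  | dec => simp [NEmits.app_iff, or_and_right, exists_or]
  | sus => simp [NEmits.susp_iff, or_assoc, or_left_comm]

theorem FCReaches.mem_iff {F : FProb} {Γ : FCtx} (h : FCReaches F Γ) (c : Atom × Var) :
    c ∈ Γ ↔ ∃ p ∈ F, NEmits p.1 p.2 c := by
  have key : ∀ s, Relation.ReflTransGen FCStep (F, ∅) s →
      ((∃ p ∈ F, NEmits p.1 p.2 c) ↔ (c ∈ s.2 ∨ ∃ p ∈ s.1, NEmits p.1 p.2 c)) := by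
    intro s hs
    induction hs with
    | refl => simp
    | tail _ hstep ih => exact ih.trans (hstep.mem_or_emits_iff c)
  simpa using (key _ h).symm

theorem FCReaches.mem_ctxSubstProb_iff {Δ Γ : FCtx} {σ : NSubst}
    (h : FCReaches (ctxSubstProb Δ σ) Γ) (c : Atom × Var) :
    c ∈ Γ ↔ ∃ d ∈ Δ, NEmits d.1 (σ d.2) c := by
  simp only [h.mem_iff, ctxSubstProb, Multiset.mem_map, exists_exists_and_eq_and, Finset.mem_val]

/-- if `σ` respects `Δ` and `θ` respects `Δσ`, then `σθ` respects
`Δ` and `(Δσ)θ = Δ(σθ)` (the instance `Δσ` is any context computed by FC from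
`{a # Xσ | a#X ∈ Δ}`; equality of the two instances is expressed for all
results computed by FC). -/
theorem respects_comp (Δ : FCtx) (σ θ : NSubst) (Γ₁ : FCtx)
    (hσ : Respects σ Δ) (h1 : FCReaches (ctxSubstProb Δ σ) Γ₁)
    (hθ : Respects θ Γ₁) :
    Respects (substComp σ θ) Δ ∧
      ∀ Γ₂ Γ₃ : FCtx, FCReaches (ctxSubstProb Γ₁ θ) Γ₂ →
        FCReaches (ctxSubstProb Δ (substComp σ θ)) Γ₃ → Γ₂ = Γ₃ := by
  refine ⟨fun a X hX ha => ?_, fun Γ₂ Γ₃ h2 h3 => ?_⟩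
  · rcases mem_FAnoSusp_substTerm θ ha with h | ⟨d, hd, h⟩
    · exact hσ a X hX h
    · exact hθ d.1 d.2 ((h1.mem_ctxSubstProb_iff d).2 ⟨(a, X), hX, hd⟩) h
  · ext c
    simp only [h2.mem_ctxSubstProb_iff, h3.mem_ctxSubstProb_iff, h1.mem_ctxSubstProb_iff,
      substComp, NEmits.substTerm_iff]
    constructor
    · rintro ⟨d, ⟨e, he, hd⟩, hc⟩
      exact ⟨e, he, d, hd, hc⟩
    · rintro ⟨e, he, d, hd, hc⟩
      exact ⟨d, ⟨e, he, hd⟩, hc⟩
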